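/- arXiv:2408.08372 — 2 statements merged into one kernel-verified Lean document; each statement's English description precedes it below -/
import Mathlib

section
/- Let W(Y) = Y - exp(Y). For |ζ| = 1 and k ∈ ℤ let L_k(ζ) denote the set of points p ∈ ℂ such that there exists a differentiable map φ : ℝ → ℂ with φ(0) = p, φ'(x) = ζ · conj(W'(φ(x))) for all x ≤ 0, and φ(x) → 2πik as x → -∞. Then for all θ, θ' ∈ (0, π/2) and all integers k, l, the intersection L_k(-e^{-iθ'}) ∩ L_l(-e^{iθ}) consists of exactly one point if k ≤ l, and is empty if k > l. -/
open Complex Filter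

/-- The superpotential `W(Y) = Y - exp Y`. -/
noncomputable def Wfc : ℂ → ℂ := fun Y => Y - Complex.exp Y

/-- The left Lefschetz thimble `L_k(ζ)` of the critical point `Y_k = 2πik`:
points `p` reached at time `0` by a solution of `φ'(x) = ζ · conj (W'(φ x))` (for `x ≤ 0`)
emanating from `2πik` in the infinite past. -/
def Thimble (k : ℤ) (ζ : ℂ) : Set ℂ :=
  {p : ℂ | ∃ φ : ℝ → ℂ, φ 0 = p ∧
    (∀ x : ℝ, x ≤ 0 → HasDerivAt φ (ζ * (starRingEnd ℂ) (deriv Wfc (φ x))) x) ∧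
    Tendsto φ atBot (nhds ((2 : ℂ) * (Real.pi : ℂ) * Complex.I * (k : ℂ)))}

lemma hasStrictDerivAt_Wfc (y : ℂ) : HasStrictDerivAt Wfc (1 - Complex.exp y) y :=
  (hasStrictDerivAt_id y).fun_sub (Complex.hasStrictDerivAt_exp y)

lemma deriv_Wfc (y : ℂ) : deriv Wfc y = 1 - Complex.exp y :=
  (hasStrictDerivAt_Wfc y).hasDerivAt.deriv

lemma exp_two_pi_I_int_add (k : ℤ) (y : ℂ) :
    Complex.exp ((2 : ℂ) * (Real.pi : ℂ) * Complex.I * (k : ℂ) + y) = Complex.exp y := by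
  rw [Complex.exp_add, mul_comm _ (k : ℂ), Complex.exp_int_mul_two_pi_mul_I, one_mul]

lemma Wfc_two_pi_I_int_add (k : ℤ) (y : ℂ) :
    Wfc ((2 : ℂ) * (Real.pi : ℂ) * Complex.I * (k : ℂ) + y) =
      (2 : ℂ) * (Real.pi : ℂ) * Complex.I * (k : ℂ) + Wfc y := by
  simp only [Wfc, exp_two_pi_I_int_add]
  ring

lemma norm_exp_sub_exp_le {δ : ℝ} {x y : ℂ} (hx : x.re ≤ -δ) (hy : y.re ≤ -δ) :
    ‖Complex.exp x - Complex.exp y‖ ≤ Real.exp (-δ) * ‖x - y‖ := by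
  refine Convex.norm_image_sub_le_of_norm_deriv_le (𝕜 := ℂ) (s := {z : ℂ | z.re ≤ -δ})
    (fun z _ => Complex.differentiableAt_exp) (fun z hz => ?_)
    (convex_halfSpace_re_le _) hy hx
  rw [Complex.deriv_exp, Complex.norm_exp]
  exact Real.exp_le_exp.2 hz

lemma Wfc_injOn_re_neg : Set.InjOn Wfc {z : ℂ | z.re < 0} := by
  intro x hx y hy h
  simp only [Set.mem_ofPred_eq] at hx hy
  set δ := min (-x.re) (-y.re)
  have hδ : 0 < δ := lt_min (by linarith) (by linarith)
  have h1 := norm_exp_sub_exp_le (δ := δ) (x := x) (y := y)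
    (by linarith [min_le_left (-x.re) (-y.re)]) (by linarith [min_le_right (-x.re) (-y.re)])
  have h2 : Complex.exp x - Complex.exp y = x - y := by
    simp only [Wfc] at h
    linear_combination -h
  rw [h2] at h1
  have h3 : Real.exp (-δ) < 1 := Real.exp_lt_one_iff.2 (by linarith)
  have h4 : ‖x - y‖ = 0 := by nlinarith [norm_nonneg (x - y)]
  exact sub_eq_zero.1 (norm_eq_zero.1 h4)

lemma exists_re_neg_Wfc_eq {w : ℂ} (hw : w.re < -1) : ∃ y : ℂ, y.re < 0 ∧ Wfc y = w := by
  obtain ⟨δ, hδ, hδw⟩ : ∃ δ : ℝ, 0 < δ ∧ w.re + Real.exp (-δ) ≤ -δ := by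
    refine ⟨min 1 (-1 - w.re), lt_min one_pos (by linarith), ?_⟩
    set δ := min 1 (-1 - w.re)
    have hδ : 0 < δ := lt_min one_pos (by linarith)
    have h1 : δ ≤ 1 := min_le_left _ _
    have h2 : δ ≤ -1 - w.re := min_le_right _ _
    have := Real.abs_exp_sub_one_sub_id_le (x := -δ) (by rw [abs_neg, abs_of_pos hδ]; exact h1)
    have h3 := (abs_le.1 this).2
    nlinarith
  let s : Set ℂ := {z : ℂ | z.re ≤ -δ}
  have hs : IsComplete s := (isClosed_le Complex.continuous_re continuous_const).isComplete
  have hm : Set.MapsTo (fun y => w + Complex.exp y) s s := by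
    intro y hy
    have h1 : (Complex.exp y).re ≤ Real.exp (-δ) :=
      (Complex.re_le_norm _).trans (by rw [Complex.norm_exp]; exact Real.exp_le_exp.2 hy)
    simp only [s, Set.mem_ofPred_eq, Complex.add_re]
    linarith
  have hc : ContractingWith (Real.exp (-δ)).toNNReal (hm.restrict _ s s) := by
    refine ⟨?_, ?_⟩
    · rw [Real.toNNReal_lt_one]
      exact Real.exp_lt_one_iff.2 (by linarith)
    · refine LipschitzWith.of_dist_le_mul fun x y => ?_
      rw [Real.coe_toNNReal _ (Real.exp_nonneg _), Subtype.dist_eq, Subtype.dist_eq,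
        dist_eq_norm, dist_eq_norm]
      simpa using norm_exp_sub_exp_le x.2 y.2
  obtain ⟨y, hy, hfix, -⟩ := ContractingWith.exists_fixedPoint' hs hm hc
    (x := ((-δ : ℝ) : ℂ)) (by simp [s]) (edist_ne_top _ _)
  refine ⟨y, lt_of_le_of_lt hy (by linarith), ?_⟩
  have : w + Complex.exp y = y := hfix
  simp only [Wfc]
  linear_combination -this

lemma eq_zero_of_exp_sub_one_sub_eq_zero {y : ℂ} (hy : y.re ≤ 0)
    (h : Complex.exp y - 1 - y = 0) : y = 0 := by
  have hre : Real.exp y.re * Real.cos y.im - 1 - y.re = 0 := by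
    simpa [Complex.exp_re] using congrArg Complex.re h
  have him : Real.exp y.re * Real.sin y.im - y.im = 0 := by
    simpa [Complex.exp_im] using congrArg Complex.im h
  have hb : y.im = 0 := by
    by_contra hb
    have h1 : |Real.sin y.im| < |y.im| := Real.abs_sin_lt_abs hb
    have h2 : |y.im| = Real.exp y.re * |Real.sin y.im| := by
      have h3 := abs_mul (Real.exp y.re) (Real.sin y.im)
      rwa [abs_of_pos (Real.exp_pos y.re), sub_eq_zero.1 him] at h3
    have h3 : Real.exp y.re ≤ 1 := Real.exp_le_one_iff.2 hy
    nlinarith [abs_nonneg (Real.sin y.im)]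
  have ha : y.re = 0 := by
    by_contra ha
    rw [hb, Real.cos_zero] at hre
    linarith [Real.add_one_lt_exp ha]
  exact Complex.ext ha hb

lemma exists_norm_lt_of_norm_exp_sub_one_sub_lt {ε : ℝ} (hε : 0 < ε) :
    ∃ δ > 0, ∀ y : ℂ, y.re ≤ 0 → ‖Complex.exp y - 1 - y‖ < δ → ‖y‖ < ε := by
  let K : Set ℂ := Metric.closedBall 0 3 ∩ {y | y.re ≤ 0} ∩ {y | ε ≤ ‖y‖}
  have hK : IsCompact K :=
    ((isCompact_closedBall _ _).inter_right
      (isClosed_le Complex.continuous_re continuous_const)).inter_right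
      (isClosed_le continuous_const continuous_norm)
  have hfar : ∀ y : ℂ, y.re ≤ 0 → 3 ≤ ‖y‖ → 1 ≤ ‖Complex.exp y - 1 - y‖ := by
    intro y hy h3
    have h1 : ‖Complex.exp y - 1‖ ≤ 2 := by
      refine (norm_sub_le _ _).trans ?_
      rw [Complex.norm_exp, norm_one]
      linarith [Real.exp_le_one_iff.2 hy]
    have h2 := norm_sub_norm_le y (Complex.exp y - 1)
    rw [norm_sub_rev y] at h2
    linarith
  rcases K.eq_empty_or_nonempty with hKe | hKn
  · refine ⟨1, one_pos, fun y hy h => ?_⟩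
    by_contra! hc
    rcases le_total 3 ‖y‖ with h3 | h3
    · linarith [hfar y hy h3]
    · have : y ∈ K := ⟨⟨by simpa using h3, hy⟩, hc⟩
      simp [hKe] at this
  · obtain ⟨z, hz, hmin⟩ := hK.exists_isMinOn hKn
      (f := fun y => ‖Complex.exp y - 1 - y‖) (by fun_prop)
    have hpos : 0 < ‖Complex.exp z - 1 - z‖ := by
      rw [norm_pos_iff]
      intro h0
      have := eq_zero_of_exp_sub_one_sub_eq_zero hz.1.2 h0
      have h2 : ε ≤ ‖z‖ := hz.2
      rw [this, norm_zero] at h2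
      linarith
    refine ⟨min 1 ‖Complex.exp z - 1 - z‖, lt_min one_pos hpos, fun y hy h => ?_⟩
    by_contra! hc
    rcases le_total 3 ‖y‖ with h3 | h3
    · linarith [hfar y hy h3, h.trans_le (min_le_left _ _)]
    · have : y ∈ K := ⟨⟨by simpa using h3, hy⟩, hc⟩
      have h4 : ‖Complex.exp z - 1 - z‖ ≤ ‖Complex.exp y - 1 - y‖ := hmin this
      linarith [h.trans_le (min_le_right _ _)]

lemma norm_exp_sub_quadratic_le {y : ℂ} (hy : ‖y‖ ≤ 1) :
    ‖Complex.exp y - 1 - y - y ^ 2 / 2‖ ≤ ‖y‖ ^ 2 / 4 := by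
  have h := Complex.exp_bound hy (n := 3) (by norm_num)
  have e : Complex.exp y - ∑ m ∈ Finset.range 3, y ^ m / (m.factorial : ℂ) =
      Complex.exp y - 1 - y - y ^ 2 / 2 := by
    simp [Finset.sum_range_succ, Nat.factorial]
    ring
  rw [e] at h
  refine h.trans ?_
  norm_num [Nat.factorial]
  have : ‖y‖ ^ 3 ≤ ‖y‖ ^ 2 := pow_le_pow_of_le_one (norm_nonneg _) hy (by norm_num)
  nlinarith [sq_nonneg ‖y‖]

lemma exists_normSq_one_sub_exp_le : ∃ C > 0, ∀ y : ℂ, y.re ≤ 0 →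
    Complex.normSq (1 - Complex.exp y) ≤ C * ‖Complex.exp y - 1 - y‖ := by
  obtain ⟨δ, hδ, H⟩ := exists_norm_lt_of_norm_exp_sub_one_sub_lt one_pos
  refine ⟨max 16 (4 / δ), lt_max_of_lt_left (by norm_num), fun y hy => ?_⟩
  rw [Complex.normSq_eq_norm_sq]
  have hn := norm_nonneg (Complex.exp y - 1 - y)
  rcases lt_or_ge ‖Complex.exp y - 1 - y‖ δ with h | h
  · have h1 := (H y hy h).le
    have h2 := Complex.norm_exp_sub_one_le h1
    have h3 := norm_exp_sub_quadratic_le h1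
    have h4 := norm_sub_norm_le (y ^ 2 / 2) (-(Complex.exp y - 1 - y - y ^ 2 / 2))
    have e : y ^ 2 / 2 - -(Complex.exp y - 1 - y - y ^ 2 / 2) = Complex.exp y - 1 - y := by ring
    rw [e, norm_neg] at h4
    have h5 : ‖y ^ 2 / 2‖ = ‖y‖ ^ 2 / 2 := by simp
    rw [norm_sub_rev]
    have h6 : ‖Complex.exp y - 1‖ ^ 2 ≤ 4 * ‖y‖ ^ 2 := by
      nlinarith [norm_nonneg (Complex.exp y - 1)]
    have h7 := mul_le_mul_of_nonneg_right (le_max_left (16 : ℝ) (4 / δ)) hn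
    linarith
  · have h1 : ‖1 - Complex.exp y‖ ≤ 2 := by
      refine (norm_sub_le _ _).trans ?_
      rw [Complex.norm_exp, norm_one]
      linarith [Real.exp_le_one_iff.2 hy]
    have h7 := mul_le_mul_of_nonneg_right (le_max_right (16 : ℝ) (4 / δ)) hn
    have h8 : 4 ≤ 4 / δ * ‖Complex.exp y - 1 - y‖ := by
      rw [div_mul_eq_mul_div, le_div_iff₀ hδ]
      linarith
    nlinarith [norm_nonneg (1 - Complex.exp y)]

lemma im_mul_im_exp_sub_nonneg {y : ℂ} (hy : ‖y‖ ≤ 1) (ha : 0 < y.re)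
    (h : 0 < (Complex.exp y - 1 - y).re) : 0 ≤ y.im * (Complex.exp y - 1 - y).im := by
  have h1 := norm_exp_sub_quadratic_le hy
  have h2 := (Complex.re_le_norm _).trans h1
  have h3 : ‖y‖ ^ 2 = y.re ^ 2 + y.im ^ 2 := by
    rw [← Complex.normSq_eq_norm_sq, Complex.normSq_apply]; ring
  have h4 : (y ^ 2 / 2).re = (y.re ^ 2 - y.im ^ 2) / 2 := by
    simp [pow_two]
  rw [Complex.sub_re _ (y ^ 2 / 2), h3, h4] at h2
  have h5 : |y.im| ≤ 1 := (Complex.abs_im_le_norm y).trans hy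
  have h6 : y.im ^ 2 ≤ 3 * y.re ^ 2 := by linarith
  have h7 : y.im ^ 2 - y.im ^ 4 / 6 ≤ y.im * Real.sin y.im := by
    rcases lt_trichotomy y.im 0 with hb | hb | hb
    · have := Real.sin_gt_sub_cube (x := -y.im) (by linarith)
      rw [Real.sin_neg] at this
      nlinarith
    · simp [hb]
    · have := Real.sin_gt_sub_cube hb
      nlinarith
  have h8 : (Complex.exp y - 1 - y).im = Real.exp y.re * Real.sin y.im - y.im := by
    simp [Complex.exp_im]
  have h9 : 1 + y.re ≤ Real.exp y.re := by linarith [Real.add_one_le_exp y.re]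
  have h10 : y.im ^ 2 ≤ 1 := by rw [← sq_abs]; nlinarith [abs_nonneg y.im]
  have h11 : y.re ≤ 1 := (Complex.re_le_norm y).trans hy
  have h12 : 0 ≤ y.im ^ 2 - y.im ^ 4 / 6 := by nlinarith [sq_nonneg y.im]
  have h13 : (1 + y.re) * (y.im ^ 2 - y.im ^ 4 / 6) ≤ Real.exp y.re * (y.im * Real.sin y.im) :=
    mul_le_mul h9 h7 h12 (Real.exp_nonneg _)
  have h14 : y.im ^ 2 ≤ 2 * y.re := by
    nlinarith
  have h15 : 0 ≤ (1 + y.re) * (1 - y.im ^ 2 / 6) - 1 := by nlinarith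
  rw [h8]
  nlinarith [mul_nonneg (sq_nonneg y.im) h15]

lemma hasDerivAt_section_Wfc {G : ℂ → ℂ} (hG : ∀ w : ℂ, w.re < -1 → (G w).re < 0 ∧ Wfc (G w) = w)
    {w : ℂ} (hw : w.re < -1) : HasDerivAt G (1 - Complex.exp (G w))⁻¹ w := by
  have hne : 1 - Complex.exp (G w) ≠ 0 := by
    intro h
    have h1 : ‖Complex.exp (G w)‖ = 1 := by rw [← sub_eq_zero.1 h, norm_one]
    rw [Complex.norm_exp, Real.exp_eq_one_iff] at h1
    linarith [(hG w hw).1]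
  have hs := hasStrictDerivAt_Wfc (G w)
  have hd := (hs.to_localInverse hne).hasDerivAt
  have hr := hs.eventually_right_inverse hne
  have h0 : hs.localInverse Wfc _ _ hne (Wfc (G w)) = G w :=
    HasStrictFDerivAt.localInverse_apply_image _
  have hc := hd.continuousAt
  rw [(hG w hw).2] at hd hr h0 hc
  refine hd.congr_of_eventuallyEq ?_
  have h1 : ∀ᶠ v in nhds w, (hs.localInverse Wfc _ _ hne v).re < 0 := by
    have : Tendsto (fun v => (hs.localInverse Wfc _ _ hne v).re) (nhds w) (nhds (G w).re) := by
      have := (Complex.continuous_re.tendsto _).comp hc.tendsto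
      rwa [h0] at this
    exact this.eventually (gt_mem_nhds (hG w hw).1)
  have h2 : ∀ᶠ v : ℂ in nhds w, v.re < -1 :=
    (Complex.continuous_re.tendsto w).eventually (gt_mem_nhds hw)
  filter_upwards [h1, h2, hr] with v h1 h2 h3
  exact Wfc_injOn_re_neg (hG v h2).1 h1 ((hG v h2).2.trans h3.symm)

/-- Solvability of the autonomous scalar equation `u' = g u` when `g` is positive, continuous and
bounded above: there is a globally defined solution that is an order isomorphism of `ℝ`. -/
lemma exists_orderIso_hasDerivAt {g : ℝ → ℝ} (hg : Continuous g) (hpos : ∀ u, 0 < g u) {C : ℝ}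
    (hC : ∀ u, g u ≤ C) : ∃ U : ℝ ≃o ℝ, ∀ x, HasDerivAt U (g (U x)) x := by
  have hC0 : 0 < C := (hpos 0).trans_le (hC 0)
  have hinv : Continuous fun u => (g u)⁻¹ := hg.inv₀ fun u => (hpos u).ne'
  let F : ℝ → ℝ := fun u => ∫ v in (0 : ℝ)..u, (g v)⁻¹
  have hF : ∀ u, HasDerivAt F (g u)⁻¹ u := fun u =>
    (hinv.integral_hasStrictDerivAt 0 u).hasDerivAt
  have hmono : StrictMono F := strictMono_of_hasDerivAt_pos hF fun u => inv_pos.2 (hpos u)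
  have hcont : Continuous F := continuous_iff_continuousAt.2 fun u => (hF u).continuousAt
  have hlin : Monotone fun u => F u - C⁻¹ * u := by
    refine monotone_of_hasDerivAt_nonneg
      (fun u => (hF u).sub ((hasDerivAt_id u).const_mul C⁻¹)) fun u => ?_
    have := inv_anti₀ (hpos u) (hC u)
    simpa using this
  have hF0 : F 0 = 0 := intervalIntegral.integral_same
  have htop : Tendsto F atTop atTop := by
    refine tendsto_atTop_mono' atTop ?_ (tendsto_id.const_mul_atTop (inv_pos.2 hC0))
    filter_upwards [eventually_ge_atTop 0] with u hu
    have := hlin hu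
    simp only [hF0, mul_zero, sub_zero] at this
    simpa using this
  have hbot : Tendsto F atBot atBot := by
    refine tendsto_atBot_mono' atBot ?_ (tendsto_id.const_mul_atBot (inv_pos.2 hC0))
    filter_upwards [eventually_le_atBot 0] with u hu
    have := hlin hu
    simp only [hF0, mul_zero, sub_zero] at this
    simpa using this
  let e := hmono.orderIsoOfSurjective F (hcont.surjective htop hbot)
  refine ⟨e.symm, fun x => ?_⟩
  have h := HasDerivAt.of_local_left_inverse (g := e.symm) (a := x)
    e.symm.continuous.continuousAt (hF (e.symm x)) (inv_pos.2 (hpos _)).ne'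
    (Eventually.of_forall fun y => e.apply_symm_apply y)
  simpa using h

lemma mem_Thimble_of_Wfc_eq {ζ : ℂ} (hζ : ‖ζ‖ = 1) (hre : ζ.re < 0) (k : ℤ) {t : ℝ} (ht : 0 < t)
    {y : ℂ} (hy : y.re < 0) (hW : Wfc y = -1 + ζ * t) :
    (2 : ℂ) * (Real.pi : ℂ) * Complex.I * (k : ℂ) + y ∈ Thimble k ζ := by
  choose! G hG using fun w : ℂ => exists_re_neg_Wfc_eq (w := w)
  have hlt : ∀ u : ℝ, (-1 + ζ * (Real.exp u : ℝ) : ℂ).re < -1 := fun u => by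
    have := mul_neg_of_neg_of_pos hre (Real.exp_pos u)
    simpa [-Complex.ofReal_exp] using this
  let γ : ℝ → ℂ := fun u => G (-1 + ζ * (Real.exp u : ℝ))
  have hγre : ∀ u, (γ u).re < 0 := fun u => (hG _ (hlt u)).1
  have hγW : ∀ u, Wfc (γ u) = -1 + ζ * (Real.exp u : ℝ) := fun u => (hG _ (hlt u)).2
  have hne : ∀ u, 1 - Complex.exp (γ u) ≠ 0 := by
    intro u h
    have h1 : ‖Complex.exp (γ u)‖ = 1 := by rw [← sub_eq_zero.1 h, norm_one]
    rw [Complex.norm_exp, Real.exp_eq_one_iff] at h1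
    linarith [hγre u]
  have hγ : ∀ u, HasDerivAt γ ((1 - Complex.exp (γ u))⁻¹ * (ζ * (Real.exp u : ℝ))) u := by
    intro u
    have h1 : HasDerivAt (fun v : ℝ => (-1 + ζ * (Real.exp v : ℝ) : ℂ)) (ζ * (Real.exp u : ℝ)) u :=
      ((Real.hasDerivAt_exp u).ofReal_comp.const_mul ζ).const_add (-1)
    exact (hasDerivAt_section_Wfc hG (hlt u)).comp u h1
  have hγc : Continuous γ := continuous_iff_continuousAt.2 fun u => (hγ u).continuousAt
  have hγn : ∀ u, ‖Complex.exp (γ u) - 1 - γ u‖ = Real.exp u := by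
    intro u
    have h : Complex.exp (γ u) - 1 - γ u = -(ζ * (Real.exp u : ℝ)) := by
      have := hγW u
      simp only [Wfc] at this
      linear_combination -this
    rw [h, norm_neg, norm_mul, hζ, one_mul, Complex.norm_real, Real.norm_eq_abs,
      abs_of_pos (Real.exp_pos u)]
  let g : ℝ → ℝ := fun u => Complex.normSq (1 - Complex.exp (γ u)) / Real.exp u
  have hgc : Continuous g :=
    (Complex.continuous_normSq.comp (continuous_const.sub (Complex.continuous_exp.comp hγc))).div
      Real.continuous_exp fun u => (Real.exp_pos u).ne'
  have hgpos : ∀ u, 0 < g u := fun u => div_pos (Complex.normSq_pos.2 (hne u)) (Real.exp_pos u)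
  obtain ⟨C, -, hC⟩ := exists_normSq_one_sub_exp_le
  have hgC : ∀ u, g u ≤ C := fun u => by
    rw [div_le_iff₀ (Real.exp_pos u)]
    simpa only [hγn u] using hC (γ u) (hγre u).le
  obtain ⟨U, hU⟩ := exists_orderIso_hasDerivAt hgc hgpos hgC
  let x₀ := U.symm (Real.log t)
  let c : ℂ := (2 : ℂ) * (Real.pi : ℂ) * Complex.I * (k : ℂ)
  refine ⟨fun x => c + γ (U (x + x₀)), ?_, fun x _ => ?_, ?_⟩
  · have h1 : U (0 + x₀) = Real.log t := by simp [x₀]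
    have h2 : γ (U (0 + x₀)) = y := by
      refine Wfc_injOn_re_neg (hγre _) hy ?_
      rw [hγW, hW, h1, Real.exp_log ht]
    simp only [h2, c]
  · have h1 : HasDerivAt (fun x => U (x + x₀)) (g (U (x + x₀))) x :=
      (hU (x + x₀)).comp_add_const x x₀
    have h2 := ((hγ (U (x + x₀))).scomp x h1).const_add c
    refine h2.congr_deriv ?_
    rw [deriv_Wfc, exp_two_pi_I_int_add]
    set u := U (x + x₀)
    have hz := Complex.mul_conj (1 - Complex.exp (γ u))
    have he : ((Real.exp u : ℝ) : ℂ) ≠ 0 := Complex.ofReal_ne_zero.2 (Real.exp_pos u).ne'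
    simp only [Complex.real_smul, g, Complex.ofReal_div]
    rw [← hz]
    have := hne u
    field_simp
  · have hlim : Tendsto (fun x => γ (U (x + x₀))) atBot (nhds 0) := by
      rw [Metric.tendsto_nhds]
      intro ε hε
      obtain ⟨δ, hδ, H⟩ := exists_norm_lt_of_norm_exp_sub_one_sub_lt hε
      have h1 : Tendsto (fun x => Real.exp (U (x + x₀))) atBot (nhds 0) :=
        Real.tendsto_exp_atBot.comp
          (U.tendsto_atBot.comp (tendsto_atBot_add_const_right _ x₀ tendsto_id))
      filter_upwards [h1.eventually (gt_mem_nhds hδ)] with x hx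
      rw [dist_zero_right]
      exact H _ (hγre _).le (by rwa [hγn])
    simpa using hlim.const_add c

lemma exists_Wfc_eq_of_trajectory {ζ : ℂ} (hζ : ‖ζ‖ = 1) (k : ℤ) {φ : ℝ → ℂ}
    (hφ : ∀ x : ℝ, x ≤ 0 → HasDerivAt φ (ζ * (starRingEnd ℂ) (deriv Wfc (φ x))) x)
    (hlim : Tendsto φ atBot (nhds ((2 : ℂ) * (Real.pi : ℂ) * Complex.I * (k : ℂ))))
    {x : ℝ} (hx : x ≤ 0) :
    ∃ t : ℝ, 0 ≤ t ∧
      Wfc (φ x) = (2 : ℂ) * (Real.pi : ℂ) * Complex.I * (k : ℂ) - 1 + ζ * t ∧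
      (t = 0 → φ x = (2 : ℂ) * (Real.pi : ℂ) * Complex.I * (k : ℂ)) := by
  set c : ℂ := (2 : ℂ) * (Real.pi : ℂ) * Complex.I * (k : ℂ) with hc
  have hWc : Wfc c = c - 1 := by
    have := Wfc_two_pi_I_int_add k 0
    rw [add_zero, ← hc] at this
    rw [this]
    simp [Wfc]
    ring
  have hζ' : (starRingEnd ℂ) ζ * ζ = 1 := by
    rw [mul_comm, Complex.mul_conj, Complex.normSq_eq_norm_sq, hζ]
    simp
  let F : ℝ → ℂ := fun x => (starRingEnd ℂ) ζ * (Wfc (φ x) - (c - 1))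
  have hF : ∀ x ≤ 0, HasDerivAt F (Complex.normSq (deriv Wfc (φ x)) : ℂ) x := by
    intro x hx
    have h1 := (((hasStrictDerivAt_Wfc (φ x)).hasDerivAt.comp x (hφ x hx)).sub_const
      (c - 1)).const_mul ((starRingEnd ℂ) ζ)
    refine h1.congr_deriv ?_
    rw [← Complex.mul_conj, ← deriv_Wfc]
    linear_combination (deriv Wfc (φ x) * (starRingEnd ℂ) (deriv Wfc (φ x))) * hζ'
  have hFlim : Tendsto F atBot (nhds 0) := by
    have h1 := (((hasStrictDerivAt_Wfc c).hasDerivAt.continuousAt.tendsto.comp hlim).sub_const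
      (c - 1)).const_mul ((starRingEnd ℂ) ζ)
    simpa [hWc] using h1
  have hre : ∀ x ≤ 0, HasDerivAt (fun x => (F x).re) (Complex.normSq (deriv Wfc (φ x))) x :=
    fun x hx => (Complex.reCLM.hasFDerivAt (x := F x)).comp_hasDerivAt x (hF x hx)
  have him : ∀ x ≤ 0, HasDerivAt (fun x => (F x).im) 0 x := fun x hx =>
    (Complex.imCLM.hasFDerivAt (x := F x)).comp_hasDerivAt x (hF x hx)
  have hmono : MonotoneOn (fun x => (F x).re) (Set.Iic 0) :=
    monotoneOn_of_hasDerivWithinAt_nonneg (convex_Iic 0)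
      (fun x hx => (hre x hx).continuousAt.continuousWithinAt)
      (fun x hx => (hre x (Set.mem_Iic.1 (interior_subset hx))).hasDerivWithinAt)
      (fun x _ => Complex.normSq_nonneg _)
  have him0 : (F x).im = 0 := by
    have h1 : ∀ z ≤ 0, (F z).im = (F x).im := fun z hz => by
      have := Convex.norm_image_sub_le_of_norm_hasDerivWithin_le (C := 0)
        (fun x hx => (him x hx).hasDerivWithinAt) (fun x _ => by simp) (convex_Iic (0 : ℝ)) hx hz
      rw [zero_mul] at this
      exact sub_eq_zero.1 (norm_le_zero_iff.1 this)
    have h2 : Tendsto (fun z => (F z).im) atBot (nhds 0) :=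
      (Complex.continuous_im.tendsto 0).comp hFlim
    refine tendsto_nhds_unique (tendsto_const_nhds.congr' ?_) h2
    filter_upwards [eventually_le_atBot 0] with z hz
    exact (h1 z hz).symm
  have hre0 : ∀ z ≤ 0, 0 ≤ (F z).re := fun z hz => by
    have h2 : Tendsto (fun z => (F z).re) atBot (nhds 0) :=
      (Complex.continuous_re.tendsto 0).comp hFlim
    refine le_of_tendsto h2 ?_
    filter_upwards [eventually_le_atBot z] with v hv
    exact hmono (hv.trans hz) hz hv
  refine ⟨(F x).re, hre0 x hx, ?_, fun h0 => ?_⟩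
  · have h1 : ((F x).re : ℂ) = F x := Complex.ext rfl (by simp [him0])
    rw [h1]
    simp only [F]
    linear_combination -(Wfc (φ x) - (c - 1)) * hζ'
  · have hzero : ∀ z ≤ x, (F z).re = 0 := fun z hz =>
      le_antisymm (h0 ▸ hmono (hz.trans hx) hx hz) (hre0 z (hz.trans hx))
    have hd : ∀ z ≤ x, HasDerivWithinAt φ 0 (Set.Iic x) z := fun z hz => by
      have h1 := (hre z (hz.trans hx)).hasDerivWithinAt (s := Set.Iic x)
      have h2 : HasDerivWithinAt (fun x => (F x).re) 0 (Set.Iic x) z :=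
        (hasDerivWithinAt_const z (Set.Iic x) (0 : ℝ)).congr (fun v hv => hzero v hv) (hzero z hz)
      have h3 := (uniqueDiffOn_Iic x z hz).eq_deriv _ h1 h2
      have h4 := (hφ z (hz.trans hx)).hasDerivWithinAt (s := Set.Iic x)
      rw [Complex.normSq_eq_zero.1 h3] at h4
      simpa using h4
    have h1 : ∀ z ≤ x, φ z = φ x := fun z hz => by
      have := Convex.norm_image_sub_le_of_norm_hasDerivWithin_le (C := 0)
        (fun x hx => hd x hx) (fun x _ => by simp) (convex_Iic x) (Set.mem_Iic.2 le_rfl) hz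
      rw [zero_mul] at this
      exact sub_eq_zero.1 (norm_le_zero_iff.1 this)
    refine tendsto_nhds_unique (tendsto_const_nhds.congr' ?_) hlim
    filter_upwards [eventually_le_atBot x] with z hz
    exact (h1 z hz).symm

lemma exists_Wfc_eq_of_mem_Thimble {ζ : ℂ} (hζ : ‖ζ‖ = 1) {k : ℤ} {p : ℂ}
    (hp : p ∈ Thimble k ζ) : ∃ t : ℝ, 0 ≤ t ∧
      Wfc p = (2 : ℂ) * (Real.pi : ℂ) * Complex.I * (k : ℂ) - 1 + ζ * t ∧
      (t = 0 → p = (2 : ℂ) * (Real.pi : ℂ) * Complex.I * (k : ℂ)) := by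
  obtain ⟨φ, rfl, hφ, hlim⟩ := hp
  exact exists_Wfc_eq_of_trajectory hζ k hφ hlim le_rfl

lemma re_ne_zero_of_Wfc_eq {ζ : ℂ} (hre : ζ.re < 0) {t : ℝ} (ht : 0 < t) {y : ℂ}
    (hW : Wfc y = -1 + ζ * t) : y.re ≠ 0 := by
  intro h
  have h1 := congrArg Complex.re hW
  simp only [Wfc, Complex.sub_re, Complex.exp_re, h, Real.exp_zero, one_mul, Complex.add_re,
    Complex.neg_re, Complex.one_re, Complex.re_mul_ofReal] at h1
  nlinarith [Real.cos_le_one y.im]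

lemma im_ne_zero_of_Wfc_eq {ζ : ℂ} (him : ζ.im ≠ 0) {t : ℝ} (ht : 0 < t) {y : ℂ}
    (hW : Wfc y = -1 + ζ * t) : y.im ≠ 0 := by
  intro h
  have h1 := congrArg Complex.im hW
  simp only [Wfc, Complex.sub_im, Complex.exp_im, h, Real.sin_zero, mul_zero, Complex.add_im,
    Complex.neg_im, Complex.one_im, Complex.im_mul_ofReal] at h1
  have := mul_ne_zero him ht.ne'
  apply this
  linarith

lemma im_mul_im_neg_of_mem_Thimble {ζ : ℂ} (hζ : ‖ζ‖ = 1) (hre : ζ.re < 0) (him : ζ.im ≠ 0)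
    {k : ℤ} {y : ℂ} (hy : (2 : ℂ) * (Real.pi : ℂ) * Complex.I * (k : ℂ) + y ∈ Thimble k ζ)
    (ha : 0 < y.re) : y.im * ζ.im < 0 := by
  obtain ⟨φ, h0, hφ, hlim⟩ := hy
  set c : ℂ := (2 : ℂ) * (Real.pi : ℂ) * Complex.I * (k : ℂ) with hc
  let ψ : ℝ → ℂ := fun x => φ x - c
  have hψ0 : ψ 0 = y := by simp [ψ, h0]
  have hψW : ∀ x ≤ 0, ∃ t : ℝ, 0 ≤ t ∧ Wfc (ψ x) = -1 + ζ * t ∧ (t = 0 → ψ x = 0) := by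
    intro x hx
    obtain ⟨t, ht, hW, h⟩ := exists_Wfc_eq_of_trajectory hζ k hφ hlim hx
    refine ⟨t, ht, ?_, fun h' => sub_eq_zero.2 (h h')⟩
    have h1 := Wfc_two_pi_I_int_add k (ψ x)
    have h2 : c + ψ x = φ x := by simp [ψ]
    rw [← hc, h2, hW] at h1
    linear_combination -h1
  have hψlim : Tendsto ψ atBot (nhds 0) := by simpa using hlim.sub_const c
  have hψc : ContinuousOn ψ (Set.Iic 0) := fun x hx =>
    ((hφ x hx).continuousAt.sub continuousAt_const).continuousWithinAt
  by_contra! hb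
  let S := ψ '' Set.Iic 0
  have hS : IsPreconnected S := isPreconnected_Iic.image ψ hψc
  let u : Set ℂ := {z | 0 < z.re ∧ 0 < z.im * ζ.im}
  let v : Set ℂ := {z | z.re < 0 ∨ z.im * ζ.im < 0} ∪ Metric.ball 0 1
  have hu : IsOpen u := (isOpen_lt continuous_const Complex.continuous_re).inter
    (isOpen_lt continuous_const (Complex.continuous_im.mul continuous_const))
  have hv : IsOpen v := ((isOpen_lt Complex.continuous_re continuous_const).union
    (isOpen_lt (Complex.continuous_im.mul continuous_const) continuous_const)).union
    Metric.isOpen_ball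
  have hcover : ∀ x ≤ 0, ψ x ≠ 0 → (ψ x).re ≠ 0 ∧ (ψ x).im * ζ.im ≠ 0 := by
    intro x hx hne
    obtain ⟨t, ht, hW, h⟩ := hψW x hx
    have ht' : 0 < t := lt_of_le_of_ne ht fun h' => hne (h h'.symm)
    exact ⟨re_ne_zero_of_Wfc_eq hre ht' hW, mul_ne_zero (im_ne_zero_of_Wfc_eq him ht' hW) him⟩
  have hSuv : S ⊆ u ∪ v := by
    rintro _ ⟨x, hx, rfl⟩
    by_cases hne : ψ x = 0
    · exact Or.inr (Or.inr (by simp [hne]))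
    · obtain ⟨h1, h2⟩ := hcover x hx hne
      rcases lt_or_gt_of_ne h1 with h1 | h1
      · exact Or.inr (Or.inl (Or.inl h1))
      · rcases lt_or_gt_of_ne h2 with h2 | h2
        · exact Or.inr (Or.inl (Or.inr h2))
        · exact Or.inl ⟨h1, h2⟩
  have hSu : (S ∩ u).Nonempty := by
    have hne : ψ 0 ≠ 0 := by
      rw [hψ0]
      rintro rfl
      simp at ha
    have h2 := (hcover 0 le_rfl hne).2
    rw [hψ0] at h2
    exact ⟨y, ⟨0, Set.mem_Iic.2 le_rfl, hψ0⟩, ha, lt_of_le_of_ne hb h2.symm⟩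
  have hSv : (S ∩ v).Nonempty := by
    obtain ⟨x, hx, hx0⟩ := ((hψlim.eventually (Metric.ball_mem_nhds 0 one_pos)).and
      (eventually_le_atBot 0)).exists
    exact ⟨ψ x, ⟨x, hx0, rfl⟩, Or.inr hx⟩
  obtain ⟨z, ⟨x, hx, rfl⟩, ⟨hz1, hz2⟩, hz3⟩ := hS u v hu hv hSuv hSu hSv
  have hz4 : ‖ψ x‖ ≤ 1 := by
    rcases hz3 with (h | h) | h
    · linarith
    · linarith
    · exact (mem_ball_zero_iff.1 h).le
  obtain ⟨t, ht, hW, h⟩ := hψW x hx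
  have ht' : 0 < t := lt_of_le_of_ne ht fun h' => by
    rw [h h'.symm] at hz1
    simp at hz1
  have he : Complex.exp (ψ x) - 1 - ψ x = -(ζ * t) := by
    simp only [Wfc] at hW
    linear_combination -hW
  have h1 := im_mul_im_exp_sub_nonneg hz4 hz1 (by
    rw [he, Complex.neg_re, Complex.re_mul_ofReal]
    nlinarith)
  rw [he, Complex.neg_im, Complex.im_mul_ofReal] at h1
  nlinarith [mul_pos hz2 ht']

lemma two_pi_I_int_mem_Thimble (k : ℤ) (ζ : ℂ) :
    (2 : ℂ) * (Real.pi : ℂ) * Complex.I * (k : ℂ) ∈ Thimble k ζ := by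
  refine ⟨fun _ => (2 : ℂ) * (Real.pi : ℂ) * Complex.I * (k : ℂ), rfl, fun x _ => ?_,
    tendsto_const_nhds⟩
  have h : Complex.exp ((2 : ℂ) * (Real.pi : ℂ) * Complex.I * (k : ℂ)) = 1 := by
    simpa using exp_two_pi_I_int_add k 0
  simpa [deriv_Wfc, h] using hasDerivAt_const x ((2 : ℂ) * (Real.pi : ℂ) * Complex.I * (k : ℂ))

theorem stmt_2 (θ θ' : ℝ) (hθ : θ ∈ Set.Ioo 0 (Real.pi / 2))
    (hθ' : θ' ∈ Set.Ioo 0 (Real.pi / 2)) (k l : ℤ) :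
    (k ≤ l →
      ∃! p : ℂ, p ∈ Thimble k (-Complex.exp (-(θ' : ℂ) * Complex.I)) ∩
        Thimble l (-Complex.exp ((θ : ℂ) * Complex.I))) ∧
    (l < k →
      Thimble k (-Complex.exp (-(θ' : ℂ) * Complex.I)) ∩
        Thimble l (-Complex.exp ((θ : ℂ) * Complex.I)) = ∅) := by
  obtain ⟨hθ0, hθ1⟩ := hθ
  obtain ⟨hθ0', hθ1'⟩ := hθ'
  have hs : 0 < Real.sin θ := Real.sin_pos_of_pos_of_lt_pi hθ0 (by linarith)
  have hs' : 0 < Real.sin θ' := Real.sin_pos_of_pos_of_lt_pi hθ0' (by linarith)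
  have hcos : 0 < Real.cos θ := Real.cos_pos_of_mem_Ioo ⟨by linarith, hθ1⟩
  have hcos' : 0 < Real.cos θ' := Real.cos_pos_of_mem_Ioo ⟨by linarith, hθ1'⟩
  set ζ : ℂ := -Complex.exp (-(θ' : ℂ) * Complex.I) with hζdef
  set η : ℂ := -Complex.exp ((θ : ℂ) * Complex.I) with hηdef
  have hζn : ‖ζ‖ = 1 := by
    rw [hζdef, norm_neg, ← Complex.ofReal_neg, Complex.norm_exp_ofReal_mul_I]
  have hηn : ‖η‖ = 1 := by rw [hηdef, norm_neg, Complex.norm_exp_ofReal_mul_I]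
  have hζre : ζ.re = -Real.cos θ' := by
    rw [hζdef, Complex.neg_re, ← Complex.ofReal_neg, Complex.exp_ofReal_mul_I_re, Real.cos_neg]
  have hζim : ζ.im = Real.sin θ' := by
    rw [hζdef, Complex.neg_im, ← Complex.ofReal_neg, Complex.exp_ofReal_mul_I_im, Real.sin_neg,
      neg_neg]
  have hηre : η.re = -Real.cos θ := by
    rw [hηdef, Complex.neg_re, Complex.exp_ofReal_mul_I_re]
  have hηim : η.im = -Real.sin θ := by
    rw [hηdef, Complex.neg_im, Complex.exp_ofReal_mul_I_im]
  have hpi := Real.pi_pos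
  have key : ∀ p ∈ Thimble k ζ ∩ Thimble l η, ∃ t s : ℝ, 0 ≤ t ∧ 0 ≤ s ∧
      Wfc p = (2 : ℂ) * (Real.pi : ℂ) * Complex.I * (k : ℂ) - 1 + ζ * t ∧
      Wfc p = (2 : ℂ) * (Real.pi : ℂ) * Complex.I * (l : ℂ) - 1 + η * s ∧
      (t = 0 → p = (2 : ℂ) * (Real.pi : ℂ) * Complex.I * (k : ℂ)) ∧
      t * Real.cos θ' = s * Real.cos θ ∧
      t * Real.sin θ' + s * Real.sin θ = 2 * Real.pi * (l - k) := by
    rintro p ⟨hk, hl⟩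
    obtain ⟨t, ht, hWt, h0⟩ := exists_Wfc_eq_of_mem_Thimble hζn hk
    obtain ⟨s, hs, hWs, -⟩ := exists_Wfc_eq_of_mem_Thimble hηn hl
    have h := hWt.symm.trans hWs
    have h1 := congrArg Complex.re h
    have h2 := congrArg Complex.im h
    simp [hζre, hηre] at h1
    simp [hζim, hηim] at h2
    exact ⟨t, s, ht, hs, hWt, hWs, h0, by linarith, by linarith⟩
  constructor
  · intro hkl
    rcases hkl.eq_or_lt with rfl | hkl
    · refine ⟨(2 : ℂ) * (Real.pi : ℂ) * Complex.I * (k : ℂ), ⟨?_, ?_⟩, fun p hp => ?_⟩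
      · exact two_pi_I_int_mem_Thimble k ζ
      · exact two_pi_I_int_mem_Thimble k η
      · obtain ⟨t, s, ht, hs0, -, -, h0, -, h2⟩ := key p hp
        refine h0 ?_
        rw [sub_self, mul_zero] at h2
        nlinarith [mul_nonneg ht hs'.le, mul_nonneg hs0 hs.le]
    · have hkl' : (0 : ℝ) < l - k := sub_pos.2 (by exact_mod_cast hkl)
      have hD : 0 < Real.sin θ * Real.cos θ' + Real.cos θ * Real.sin θ' := by positivity
      set D := Real.sin θ * Real.cos θ' + Real.cos θ * Real.sin θ' with hDdef
      set t₀ : ℝ := 2 * Real.pi * (l - k) * Real.cos θ / D with ht₀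
      set s₀ : ℝ := 2 * Real.pi * (l - k) * Real.cos θ' / D with hs₀
      have ht₀pos : 0 < t₀ := by positivity
      have hs₀pos : 0 < s₀ := by positivity
      have hre₀ : t₀ * Real.cos θ' = s₀ * Real.cos θ := by
        rw [ht₀, hs₀]
        ring
      have him₀ : t₀ * Real.sin θ' + s₀ * Real.sin θ = 2 * Real.pi * (l - k) := by
        rw [ht₀, hs₀]
        field_simp
        rw [hDdef]
        ring
      clear_value t₀ s₀
      have hunique : ∀ p ∈ Thimble k ζ ∩ Thimble l η, p.re < 0 ∧
          Wfc p = (2 : ℂ) * (Real.pi : ℂ) * Complex.I * (k : ℂ) - 1 + ζ * t₀ := by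
        intro p hp
        obtain ⟨t, s, ht, hs0, hWt, hWs, -, h1, h2⟩ := key p hp
        have htt : t = t₀ := by
          rw [ht₀, eq_div_iff hD.ne', ← h2, hDdef]
          linear_combination Real.sin θ * h1
        have hss : s = s₀ := by
          rw [hs₀, eq_div_iff hD.ne', ← h2, hDdef]
          linear_combination -Real.sin θ' * h1
        subst htt hss
        refine ⟨?_, hWt⟩
        have hsplit : ∀ m : ℤ, (2 : ℂ) * (Real.pi : ℂ) * Complex.I * (m : ℂ) +
            (p - (2 : ℂ) * (Real.pi : ℂ) * Complex.I * (m : ℂ)) = p := fun m => by ring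
        have hpre : ∀ m : ℤ,
            (p - (2 : ℂ) * (Real.pi : ℂ) * Complex.I * (m : ℂ)).re = p.re := by simp
        have hpim : ∀ m : ℤ,
            (p - (2 : ℂ) * (Real.pi : ℂ) * Complex.I * (m : ℂ)).im =
              p.im - 2 * Real.pi * m := by simp
        have hne : p.re ≠ 0 := by
          rw [← hpre k]
          refine re_ne_zero_of_Wfc_eq (ζ := ζ) (by rw [hζre]; linarith) ht₀pos ?_
          have := Wfc_two_pi_I_int_add k (p - (2 : ℂ) * (Real.pi : ℂ) * Complex.I * (k : ℂ))
          rw [hsplit, hWt] at this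
          linear_combination -this
        by_contra! hge
        have hpos : 0 < p.re := lt_of_le_of_ne hge hne.symm
        have hk := im_mul_im_neg_of_mem_Thimble hζn (by rw [hζre]; linarith)
          (by rw [hζim]; exact hs'.ne') ((hsplit k).symm ▸ hp.1) (by rwa [hpre])
        have hl := im_mul_im_neg_of_mem_Thimble hηn (by rw [hηre]; linarith)
          (by rw [hηim]; linarith) ((hsplit l).symm ▸ hp.2) (by rwa [hpre])
        rw [hpim, hζim] at hk
        rw [hpim, hηim] at hl
        have hk1 : p.im - 2 * Real.pi * k < 0 := by nlinarith
        have hl1 : 0 < p.im - 2 * Real.pi * l := by nlinarith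
        nlinarith [mul_pos hpi hkl']
      obtain ⟨y, hy, hWy⟩ := exists_re_neg_Wfc_eq (w := -1 + ζ * t₀) (by
        have := mul_pos hcos' ht₀pos
        simp only [Complex.add_re, Complex.neg_re, Complex.one_re, Complex.re_mul_ofReal, hζre]
        linarith)
      refine ⟨(2 : ℂ) * (Real.pi : ℂ) * Complex.I * (k : ℂ) + y, ⟨?_, ?_⟩, fun p hp => ?_⟩
      · exact mem_Thimble_of_Wfc_eq hζn (by rw [hζre]; linarith) k ht₀pos hy hWy
      · have h := Wfc_two_pi_I_int_add (k - l) y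
        have hmem := mem_Thimble_of_Wfc_eq hηn (by rw [hηre]; linarith) l hs₀pos
          (y := (2 : ℂ) * (Real.pi : ℂ) * Complex.I * ((k - l : ℤ) : ℂ) + y)
          (by simpa using hy) (by
            rw [h, hWy]
            apply Complex.ext
            · simp [hζre, hηre]
              linarith
            · simp [hζim, hηim]
              linarith)
        convert hmem using 1
        push_cast
        ring
      · obtain ⟨hpre, hWp⟩ := hunique p hp
        refine Wfc_injOn_re_neg hpre (by simpa using hy) ?_
        rw [hWp, Wfc_two_pi_I_int_add, hWy]
        ring
  · intro hlk
    refine Set.eq_empty_of_forall_notMem fun p hp => ?_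
    obtain ⟨t, s, ht, hs0, -, -, -, -, h2⟩ := key p hp
    have h3 : ((l : ℝ) - k) < 0 := sub_neg.2 (by exact_mod_cast hlk)
    nlinarith [mul_nonneg ht hs'.le, mul_nonneg hs0 hs.le, mul_neg_of_pos_of_neg hpi h3]
end

section
/- Let W(Y) = Y - exp(Y), whose critical points are Y_k = 2πik, k ∈ ℤ. (i) There exists a differentiable map φ : ℝ → ℂ satisfying φ'(x) = i · conj(1 - exp(φ(x))) for all x ∈ ℝ, with φ(x) → 0 as x → -∞ and φ(x) → 2πi as x → +∞; and any two such maps φ, ψ satisfy ψ(x) = φ(x + c) for all x, for some real constant c. (ii) For every integer n ≥ 2 there is no differentiable map φ : ℝ → ℂ satisfying φ'(x) = i · conj(1 - exp(φ(x))) for all x ∈ ℝ with φ(x) → 0 as x → -∞ and φ(x) → 2πin as x → +∞. -/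
open Complex Filter

/-- A soliton of `W(Y) = Y - exp Y` at phase `ζ = i`, running from `0` at `x → -∞`
to `b` at `x → +∞`: it solves `φ'(x) = i · conj (1 - exp (φ x))`. -/
def IsClosedSolitonTo (b : ℂ) (φ : ℝ → ℂ) : Prop :=
  (∀ x : ℝ, HasDerivAt φ (Complex.I * (starRingEnd ℂ) (1 - Complex.exp (φ x))) x) ∧
    Tendsto φ atBot (nhds 0) ∧ Tendsto φ atTop (nhds b)

open Set Topology

/-- A function with positive derivative on an open convex set of reals, onto an open target,
has a differentiable right inverse there. -/
theorem exists_hasDerivAt_inverse {f f' : ℝ → ℝ} {S T : Set ℝ} (hS : IsOpen S)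
    (hconv : Convex ℝ S) (hT : IsOpen T) (hf : ∀ x ∈ S, HasDerivAt f (f' x) x)
    (hpos : ∀ x ∈ S, 0 < f' x) (hmaps : MapsTo f S T) (hsurj : SurjOn f S T) :
    ∃ g : ℝ → ℝ, StrictMonoOn g T ∧
      ∀ y ∈ T, g y ∈ S ∧ f (g y) = y ∧ HasDerivAt g (f' (g y))⁻¹ y := by
  have hmono : StrictMonoOn f S :=
    strictMonoOn_of_deriv_pos hconv (fun x hx => (hf x hx).continuousAt.continuousWithinAt)
      fun x hx => by
        rw [(hf x (interior_subset hx)).deriv]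
        exact hpos x (interior_subset hx)
  choose! g hgS hfg using hsurj
  have hgmono : StrictMonoOn g T := fun a ha b hb hab => by
    rwa [← hmono.lt_iff_lt (hgS ha) (hgS hb), hfg ha, hfg hb]
  refine ⟨g, hgmono, fun y hy => ⟨hgS hy, hfg hy, ?_⟩⟩
  have himage : S ⊆ g '' T := fun x hx =>
    ⟨f x, hmaps hx, hmono.injOn (hgS (hmaps hx)) hx (hfg (hmaps hx))⟩
  have hcont : ContinuousAt g y :=
    continuousAt_of_monotoneOn_of_image_mem_nhds hgmono.monotoneOn (hT.mem_nhds hy)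
      (mem_of_superset (hS.mem_nhds (hgS hy)) himage)
  exact HasDerivAt.of_local_left_inverse hcont (hf _ (hgS hy)) (hpos _ (hgS hy)).ne'
    (mem_of_superset (hT.mem_nhds hy) fun z hz => hfg hz)

theorem hasDerivAt_one_add_mul_exp_neg (u : ℝ) :
    HasDerivAt (fun u : ℝ => (1 + u) * Real.exp (-u)) (-u * Real.exp (-u)) u := by
  convert! ((hasDerivAt_id u).const_add 1).mul (hasDerivAt_neg u).exp using 1
  simp only [id]
  ring

theorem one_add_mul_exp_neg_lt_one {u : ℝ} (hu : u ≠ 0) : (1 + u) * Real.exp (-u) < 1 := by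
  rw [Real.exp_neg, ← div_eq_mul_inv, div_lt_one (Real.exp_pos u)]
  linarith [Real.add_one_lt_exp hu]

theorem one_add_mul_exp_neg_le {u : ℝ} (hu : u ≤ 0) :
    (1 + u) * Real.exp (-u) ≤ 1 - u ^ 2 / 2 := by
  have hd : ∀ x : ℝ, HasDerivAt (fun u : ℝ => 1 - u ^ 2 / 2 - (1 + u) * Real.exp (-u))
      (x * (Real.exp (-x) - 1)) x := fun x => by
    convert! (((hasDerivAt_pow 2 x).div_const 2).const_sub 1).sub
      (hasDerivAt_one_add_mul_exp_neg x) using 1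
    push_cast
    ring
  have hanti : Antitone fun u : ℝ => 1 - u ^ 2 / 2 - (1 + u) * Real.exp (-u) :=
    antitone_of_deriv_nonpos (fun x => (hd x).differentiableAt) fun x => by
      rw [(hd x).deriv]
      rcases le_total 0 x with hx | hx
      · exact mul_nonpos_of_nonneg_of_nonpos hx (by simpa using hx)
      · exact mul_nonpos_of_nonpos_of_nonneg hx (by simpa using hx)
  have := hanti hu
  simp only [neg_zero, Real.exp_zero] at this
  linarith

/-- The negative branch of the level curve `(1 + u) * exp (-u) = cos v`, `0 < v < 2π`. -/
theorem exists_level_curve : ∃ g : ℝ → ℝ, ∀ v ∈ Ioo 0 (2 * Real.pi),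
    g v < 0 ∧ (1 + g v) * Real.exp (-g v) = Real.cos v ∧
      HasDerivAt g (Real.exp (g v) * Real.sin v / g v) v := by
  obtain ⟨k, -, hk⟩ := exists_hasDerivAt_inverse (S := Iio 0) (T := Iio 1) isOpen_Iio
    (convex_Iio 0) isOpen_Iio (fun u _ => hasDerivAt_one_add_mul_exp_neg u)
    (fun u hu => mul_pos (neg_pos.2 hu) (Real.exp_pos _))
    (fun u hu => one_add_mul_exp_neg_lt_one (ne_of_lt hu)) (by
      intro y hy
      have hle : -(|y| + 2) ≤ 0 := by linarith [abs_nonneg y]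
      have hcont : Continuous fun u : ℝ => (1 + u) * Real.exp (-u) := by fun_prop
      obtain ⟨u, hu, huy⟩ := intermediate_value_Ico hle hcont.continuousOn
        (show y ∈ Ico _ _ from ⟨by
          refine (one_add_mul_exp_neg_le hle).trans ?_
          nlinarith [abs_nonneg y, neg_abs_le y], by simpa using hy⟩)
      exact ⟨u, hu.2, huy⟩)
  refine ⟨fun v => k (Real.cos v), fun v hv => ?_⟩
  have hcos : Real.cos v < 1 := by
    refine lt_of_le_of_ne (Real.cos_le_one v) fun h => hv.1.ne' ?_
    exact (Real.cos_eq_one_iff_of_lt_of_lt (by linarith [hv.1, Real.pi_pos]) hv.2).1 h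
  obtain ⟨h1, h2, h3⟩ := hk _ hcos
  refine ⟨h1, h2, ?_⟩
  convert! h3.comp v (Real.hasDerivAt_cos v) using 1
  have h1' : k (Real.cos v) ≠ 0 := ne_of_lt h1
  rw [Real.exp_neg]
  have := Real.exp_pos (k (Real.cos v))
  field_simp

theorem neg_le_of_level_curve {u v : ℝ} (hu : u ≤ 0) (hv : 0 ≤ v)
    (h : (1 + u) * Real.exp (-u) = Real.cos v) : -u ≤ v := by
  have h1 := one_add_mul_exp_neg_le hu
  have h2 := Real.one_sub_sq_div_two_le_cos (x := v)
  exact le_of_sq_le_sq (by nlinarith) hv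

/-- The autonomous equation `v' = s v` on `(0, b)`, where `s` is positive and vanishes at most
linearly at both endpoints, has a complete orbit joining `0` to `b`. -/
theorem exists_heteroclinic {b : ℝ} (hb : 0 < b) {s : ℝ → ℝ} (hs : ContinuousOn s (Ioo 0 b))
    (hpos : ∀ v ∈ Ioo 0 b, 0 < s v) (hle : ∀ v ∈ Ioo 0 b, s v ≤ v)
    (hle' : ∀ v ∈ Ioo 0 b, s v ≤ b - v) :
    ∃ V : ℝ → ℝ, (∀ x, V x ∈ Ioo 0 b) ∧ (∀ x, HasDerivAt V (s (V x)) x) ∧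
      Tendsto V atBot (𝓝 0) ∧ Tendsto V atTop (𝓝 b) := by
  set m := b / 2 with hm
  have hmI : m ∈ Ioo 0 b := ⟨by linarith, by linarith⟩
  set T : ℝ → ℝ := fun v => ∫ w in m..v, (s w)⁻¹
  have hinv : ContinuousOn (fun w => (s w)⁻¹) (Ioo 0 b) := hs.inv₀ fun v hv => (hpos v hv).ne'
  have hT : ∀ v ∈ Ioo 0 b, HasDerivAt T (s v)⁻¹ v := fun v hv =>
    intervalIntegral.integral_hasDerivAt_right
      ((hinv.mono (ordConnected_Ioo.uIcc_subset hmI hv)).intervalIntegrable)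
      (hinv.stronglyMeasurableAtFilter isOpen_Ioo v hv) (hinv.continuousAt (isOpen_Ioo.mem_nhds hv))
  have hTm : T m = 0 := intervalIntegral.integral_same
  have hlow : MonotoneOn (fun v => T v - Real.log v) (Ioo 0 b) := by
    have hd : ∀ v ∈ Ioo 0 b, HasDerivAt (fun v => T v - Real.log v) ((s v)⁻¹ - v⁻¹) v :=
      fun v hv => (hT v hv).sub (Real.hasDerivAt_log hv.1.ne')
    refine monotoneOn_of_deriv_nonneg (convex_Ioo 0 b)
      (fun v hv => (hd v hv).continuousAt.continuousWithinAt)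
      (fun v hv => (hd v (interior_subset hv)).differentiableAt.differentiableWithinAt)
      fun v hv => ?_
    have hv := interior_subset hv
    rw [(hd v hv).deriv, sub_nonneg]
    exact inv_anti₀ (hpos v hv) (hle v hv)
  have hhigh : MonotoneOn (fun v => T v + Real.log (b - v)) (Ioo 0 b) := by
    have hd : ∀ v ∈ Ioo 0 b,
        HasDerivAt (fun v => T v + Real.log (b - v)) ((s v)⁻¹ + -1 / (b - v)) v :=
      fun v hv => (hT v hv).add (((hasDerivAt_id v).const_sub b).log (sub_pos.2 hv.2).ne')
    refine monotoneOn_of_deriv_nonneg (convex_Ioo 0 b)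
      (fun v hv => (hd v hv).continuousAt.continuousWithinAt)
      (fun v hv => (hd v (interior_subset hv)).differentiableAt.differentiableWithinAt)
      fun v hv => ?_
    have hv := interior_subset hv
    have := inv_anti₀ (hpos v hv) (hle' v hv)
    rw [(hd v hv).deriv, neg_div, one_div]
    linarith
  have hsurj : SurjOn T (Ioo 0 b) univ := fun x _ => by
    set e := m * Real.exp (-|x|) with he
    have he0 : 0 < e := mul_pos hmI.1 (Real.exp_pos _)
    have hem : e ≤ m := mul_le_of_le_one_right hmI.1.le (by simp)
    have hloge : Real.log e = Real.log m - |x| := by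
      rw [he, Real.log_mul hmI.1.ne' (Real.exp_pos _).ne', Real.log_exp, sub_eq_add_neg]
    have heI : e ∈ Ioo 0 b := ⟨he0, hem.trans_lt hmI.2⟩
    have heI' : b - e ∈ Ioo 0 b := ⟨by linarith [heI.2], by linarith⟩
    have h1 : T e ≤ x := by
      have := hlow heI hmI hem
      simp only [hTm, hloge] at this
      linarith [neg_abs_le x]
    have h2 : x ≤ T (b - e) := by
      have := hhigh hmI heI' (by linarith)
      simp only [hTm, sub_sub_cancel, hloge, show b - m = m by linarith] at this
      linarith [le_abs_self x]
    have hsub : Icc e (b - e) ⊆ Ioo 0 b := ordConnected_Ioo.out heI heI'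
    obtain ⟨v, hv, hvx⟩ := intermediate_value_Icc (by linarith : e ≤ b - e)
      (fun v hv => (hT v (hsub hv)).continuousAt.continuousWithinAt) ⟨h1, h2⟩
    exact ⟨v, hsub hv, hvx⟩
  obtain ⟨V, hVmono, hV⟩ := exists_hasDerivAt_inverse isOpen_Ioo (convex_Ioo 0 b) isOpen_univ hT
    (fun v hv => inv_pos.2 (hpos v hv)) (mapsTo_univ _ _) hsurj
  have hVI : ∀ x, V x ∈ Ioo 0 b := fun x => (hV x trivial).1
  have hVT : ∀ v ∈ Ioo 0 b, V (T v) = v := by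
    have hTmono : StrictMonoOn T (Ioo 0 b) :=
      strictMonoOn_of_deriv_pos (convex_Ioo 0 b)
        (fun x hx => (hT x hx).continuousAt.continuousWithinAt) fun x hx => by
          rw [(hT x (interior_subset hx)).deriv]
          exact inv_pos.2 (hpos x (interior_subset hx))
    exact fun v hv => hTmono.injOn (hVI _) hv (hV _ trivial).2.1
  refine ⟨V, hVI, fun x => by simpa using (hV x trivial).2.2, ?_, ?_⟩
  · refine tendsto_order.2 ⟨fun a ha => .of_forall fun x => ha.trans (hVI x).1, fun a ha => ?_⟩
    have hI : min a m ∈ Ioo 0 b := ⟨lt_min ha hmI.1, (min_le_right _ _).trans_lt hmI.2⟩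
    filter_upwards [eventually_lt_atBot (T (min a m))] with x hx
    have := hVmono (mem_univ _) (mem_univ _) hx
    rw [hVT _ hI] at this
    exact this.trans_le (min_le_left _ _)
  · refine tendsto_order.2 ⟨fun a ha => ?_, fun a ha => .of_forall fun x => (hVI x).2.trans ha⟩
    have hI : max a m ∈ Ioo 0 b := ⟨hmI.1.trans_le (le_max_right _ _), max_lt ha hmI.2⟩
    filter_upwards [eventually_gt_atTop (T (max a m))] with x hx
    have := hVmono (mem_univ _) (mem_univ _) hx
    rw [hVT _ hI] at this
    exact (le_max_left _ _).trans_lt this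

theorem I_mul_conj_one_sub_exp (u v : ℝ) :
    I * (starRingEnd ℂ) (1 - Complex.exp (u + v * I)) =
      ((-(Real.exp u * Real.sin v) : ℝ) : ℂ) + ((1 - Real.exp u * Real.cos v : ℝ) : ℂ) * I := by
  apply Complex.ext <;> simp [Complex.exp_re, Complex.exp_im, Complex.cos_ofReal_re,
    Complex.sin_ofReal_re]

theorem exists_closedSoliton : ∃ φ : ℝ → ℂ, IsClosedSolitonTo (2 * Real.pi * I) φ := by
  obtain ⟨g, hg⟩ := exists_level_curve
  have hle : ∀ v ∈ Ioo 0 (2 * Real.pi), -g v ≤ v := fun v hv =>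
    neg_le_of_level_curve (hg v hv).1.le hv.1.le (hg v hv).2.1
  have hle' : ∀ v ∈ Ioo 0 (2 * Real.pi), -g v ≤ 2 * Real.pi - v := fun v hv =>
    neg_le_of_level_curve (hg v hv).1.le (sub_nonneg.2 hv.2.le)
      (by rw [(hg v hv).2.1, Real.cos_two_pi_sub])
  obtain ⟨V, hVI, hV, hbot, htop⟩ := exists_heteroclinic Real.two_pi_pos (s := fun v => -g v)
    (fun v hv => (hg v hv).2.2.continuousAt.neg.continuousWithinAt)
    (fun v hv => neg_pos.2 (hg v hv).1) hle hle'
  have hub : Tendsto (fun x => g (V x)) atBot (𝓝 0) :=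
    tendsto_of_tendsto_of_tendsto_of_le_of_le (by simpa using hbot.neg) tendsto_const_nhds
      (fun x => by linarith [hle _ (hVI x)]) fun x => (hg _ (hVI x)).1.le
  have hut : Tendsto (fun x => g (V x)) atTop (𝓝 0) :=
    tendsto_of_tendsto_of_tendsto_of_le_of_le
      (by simpa using htop.sub_const (2 * Real.pi)) tendsto_const_nhds
      (fun x => by linarith [hle' _ (hVI x)]) fun x => (hg _ (hVI x)).1.le
  refine ⟨fun x => (g (V x) : ℂ) + V x * I, fun x => ?_, ?_, ?_⟩
  · obtain ⟨h1, h2, h3⟩ := hg _ (hVI x)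
    rw [I_mul_conj_one_sub_exp]
    have hu : HasDerivAt (fun x => g (V x)) (-(Real.exp (g (V x)) * Real.sin (V x))) x := by
      convert! h3.comp x (hV x) using 1
      field_simp [h1.ne]
    have hv : HasDerivAt V (1 - Real.exp (g (V x)) * Real.cos (V x)) x := by
      convert! hV x using 1
      rw [← h2, Real.exp_neg]
      field_simp
      ring
    exact hu.ofReal_comp.add (hv.ofReal_comp.mul_const I)
  · simpa using (hub.ofReal.add (hbot.ofReal.mul_const I))
  · simpa using (hut.ofReal.add (htop.ofReal.mul_const I))

/-- Two solutions of `φ' = i · conj (1 - exp φ)` that meet coincide. -/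
theorem soliton_ode_unique {φ ψ : ℝ → ℂ}
    (hφ : ∀ x, HasDerivAt φ (I * (starRingEnd ℂ) (1 - Complex.exp (φ x))) x)
    (hψ : ∀ x, HasDerivAt ψ (I * (starRingEnd ℂ) (1 - Complex.exp (ψ x))) x)
    {x₀ : ℝ} (h : φ x₀ = ψ x₀) : φ = ψ := by
  ext1 x
  have hC : ContDiff ℝ 1 fun z : ℂ => I * (starRingEnd ℂ) (1 - Complex.exp z) := by
    have : ContDiff ℝ 1 fun z : ℂ => Complex.exp z := Complex.contDiff_exp
    exact contDiff_const.mul (Complex.conjCLE.contDiff.comp (contDiff_const.sub this))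
  set R := |x| + |x₀| + 1
  have hφc : Continuous φ := continuous_iff_continuousAt.2 fun x => (hφ x).continuousAt
  have hψc : Continuous ψ := continuous_iff_continuousAt.2 fun x => (hψ x).continuousAt
  obtain ⟨K, hK⟩ := LocallyLipschitzOn.exists_lipschitzOnWith_of_compact
    ((isCompact_Icc.image hφc).union (isCompact_Icc.image hψc))
    (hC.locallyLipschitz.locallyLipschitzOn (s := φ '' Icc (-R) R ∪ ψ '' Icc (-R) R))
  exact ODE_solution_unique_of_mem_Ioo (a := -R) (b := R) (t₀ := x₀) (fun _ _ => hK)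
    (abs_lt.1 (by linarith [abs_nonneg x] : |x₀| < R))
    (fun t ht => ⟨hφ t, .inl ⟨t, Ioo_subset_Icc_self ht, rfl⟩⟩)
    (fun t ht => ⟨hψ t, .inr ⟨t, Ioo_subset_Icc_self ht, rfl⟩⟩) h
    (abs_lt.1 (by linarith [abs_nonneg x₀] : |x| < R))

namespace IsClosedSolitonTo

variable {φ : ℝ → ℂ} {b : ℂ}

theorem hasDerivAt_re (h : IsClosedSolitonTo b φ) (x : ℝ) :
    HasDerivAt (fun x => (φ x).re) (-(Real.exp (φ x).re * Real.sin (φ x).im)) x := by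
  convert! Complex.reCLM.hasFDerivAt.comp_hasDerivAt x (h.1 x) using 1
  simp [Complex.exp_im]

theorem hasDerivAt_im (h : IsClosedSolitonTo b φ) (x : ℝ) :
    HasDerivAt (fun x => (φ x).im) (1 - Real.exp (φ x).re * Real.cos (φ x).im) x := by
  convert! Complex.imCLM.hasFDerivAt.comp_hasDerivAt x (h.1 x) using 1
  simp [Complex.exp_re]

/-- Conservation of `Re W` along a soliton. -/
theorem exp_re_mul_cos_im (h : IsClosedSolitonTo b φ) (x : ℝ) :
    Real.exp (φ x).re * Real.cos (φ x).im = 1 + (φ x).re := by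
  set H : ℝ → ℝ := fun x => (φ x).re - Real.exp (φ x).re * Real.cos (φ x).im
  have hd : ∀ x, HasDerivAt H 0 x := fun x => by
    convert! (h.hasDerivAt_re x).sub ((h.hasDerivAt_re x).exp.mul (h.hasDerivAt_im x).cos) using 1
    ring
  have hconst : ∀ y, H y = H x := fun y =>
    is_const_of_deriv_eq_zero (fun x => (hd x).differentiableAt) (fun x => (hd x).deriv) y x
  have hre : Tendsto (fun x => (φ x).re) atBot (𝓝 0) :=
    (Complex.continuous_re.tendsto 0).comp h.2.1
  have him : Tendsto (fun x => (φ x).im) atBot (𝓝 0) :=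
    (Complex.continuous_im.tendsto 0).comp h.2.1
  have hlim : Tendsto H atBot (𝓝 (0 - Real.exp 0 * Real.cos 0)) :=
    hre.sub (((Real.continuous_exp.tendsto 0).comp hre).mul
      ((Real.continuous_cos.tendsto 0).comp him))
  have := tendsto_nhds_unique hlim ((tendsto_congr hconst).2 tendsto_const_nhds)
  simp only [Real.exp_zero, Real.cos_zero, H] at this
  linarith

theorem cos_im (h : IsClosedSolitonTo b φ) (x : ℝ) :
    (1 + (φ x).re) * Real.exp (-(φ x).re) = Real.cos (φ x).im := by
  rw [← h.exp_re_mul_cos_im x, Real.exp_neg]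
  field_simp

theorem hasDerivAt_im' (h : IsClosedSolitonTo b φ) (x : ℝ) :
    HasDerivAt (fun x => (φ x).im) (-(φ x).re) x := by
  convert! h.hasDerivAt_im x using 1
  rw [h.exp_re_mul_cos_im x]
  ring

theorem re_ne_zero (h : IsClosedSolitonTo b φ) (hb : b ≠ 0) (x : ℝ) : (φ x).re ≠ 0 := by
  intro hx
  have hcos := h.cos_im x
  simp only [hx, neg_zero, Real.exp_zero, add_zero, mul_one] at hcos
  have hexp : Complex.exp (φ x) = 1 := by
    have hsin := (Real.sin_eq_zero_iff_cos_eq (x := (φ x).im)).2 (.inl hcos.symm)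
    apply Complex.ext <;> simp [Complex.exp_re, Complex.exp_im, hx, ← hcos, hsin]
  have hconst : φ = fun _ => φ x :=
    soliton_ode_unique h.1 (fun y => by simpa [hexp] using hasDerivAt_const y (φ x)) rfl
  have h0 := h.2.1
  have h1 := h.2.2
  rw [hconst] at h0 h1
  exact hb ((tendsto_nhds_unique h1 tendsto_const_nhds).trans
    (tendsto_nhds_unique tendsto_const_nhds h0))

theorem tendsto_im_atBot (h : IsClosedSolitonTo b φ) :
    Tendsto (fun x => (φ x).im) atBot (𝓝 0) :=
  (Complex.continuous_im.tendsto 0).comp h.2.1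

theorem tendsto_im_atTop (h : IsClosedSolitonTo b φ) :
    Tendsto (fun x => (φ x).im) atTop (𝓝 b.im) :=
  (Complex.continuous_im.tendsto b).comp h.2.2

theorem exists_im_eq (h : IsClosedSolitonTo b φ) {w : ℝ} (h0 : 0 < w) (hw : w < b.im) :
    ∃ x, (φ x).im = w :=
  mem_range_of_exists_le_of_exists_ge
    (continuous_iff_continuousAt.2 fun x => (h.hasDerivAt_im x).continuousAt)
    ((h.tendsto_im_atBot.eventually_lt_const h0).exists.imp fun _ => le_of_lt)
    ((h.tendsto_im_atTop.eventually_const_lt hw).exists.imp fun _ => le_of_lt)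

theorem re_neg (h : IsClosedSolitonTo b φ) (hb : 0 < b.im) (x : ℝ) : (φ x).re < 0 := by
  have hne := h.re_ne_zero fun hb0 => by simp [hb0] at hb
  have hc : Continuous fun x => (φ x).re :=
    continuous_iff_continuousAt.2 fun x => (h.hasDerivAt_re x).continuousAt
  by_contra! hx
  have hall : ∀ y, 0 ≤ (φ y).re := fun y => by
    by_contra! hy
    obtain ⟨z, hz⟩ := mem_range_of_exists_le_of_exists_ge hc ⟨y, hy.le⟩ ⟨x, hx⟩
    exact hne z hz
  have hanti : Antitone fun x => (φ x).im :=
    antitone_of_deriv_nonpos (fun y => (h.hasDerivAt_im' y).differentiableAt) fun y => by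
      rw [(h.hasDerivAt_im' y).deriv]
      exact neg_nonpos.2 (hall y)
  exact hb.not_ge ((hanti.le_of_tendsto h.tendsto_im_atTop 0).trans
    (hanti.ge_of_tendsto h.tendsto_im_atBot 0))

end IsClosedSolitonTo

theorem IsClosedSolitonTo.eq_translate {b : ℂ} (hb : 0 < b.im) {φ ψ : ℝ → ℂ}
    (hφ : IsClosedSolitonTo b φ) (hψ : IsClosedSolitonTo b ψ) :
    ∃ c : ℝ, ∀ x : ℝ, ψ x = φ (x + c) := by
  obtain ⟨p, hp⟩ := hφ.exists_im_eq (half_pos hb) (half_lt_self hb)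
  obtain ⟨q, hq⟩ := hψ.exists_im_eq (half_pos hb) (half_lt_self hb)
  have hinj : InjOn (fun u : ℝ => (1 + u) * Real.exp (-u)) (Iio 0) :=
    (strictMonoOn_of_deriv_pos (convex_Iio 0) (by fun_prop) fun u hu => by
      rw [(hasDerivAt_one_add_mul_exp_neg u).deriv]
      exact mul_pos (neg_pos.2 (mem_Iio.1 (interior_subset (s := Iio (0 : ℝ)) hu))) (Real.exp_pos _)).injOn
  have hre : (ψ q).re = (φ p).re := hinj (hψ.re_neg hb q) (hφ.re_neg hb p) <| by
    simp only [hψ.cos_im, hφ.cos_im, hp, hq]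
  refine ⟨p - q, congrFun (soliton_ode_unique hψ.1 (fun x => ?_) (x₀ := q) ?_)⟩
  · exact (hφ.1 (x + (p - q))).comp_add_const x (p - q)
  · rw [add_sub_cancel]
    exact Complex.ext hre (hq.trans hp.symm)

theorem stmt_16 :
    -- (i) existence and uniqueness up to translation for winding number 1
    ((∃ φ : ℝ → ℂ, IsClosedSolitonTo ((2 : ℂ) * (Real.pi : ℂ) * Complex.I) φ) ∧
      (∀ φ ψ : ℝ → ℂ,
        IsClosedSolitonTo ((2 : ℂ) * (Real.pi : ℂ) * Complex.I) φ →
        IsClosedSolitonTo ((2 : ℂ) * (Real.pi : ℂ) * Complex.I) ψ →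
        ∃ c : ℝ, ∀ x : ℝ, ψ x = φ (x + c))) ∧
    -- (ii) non-existence for winding number n ≥ 2
    (∀ n : ℤ, 2 ≤ n →
      ¬ ∃ φ : ℝ → ℂ,
          IsClosedSolitonTo ((2 : ℂ) * (Real.pi : ℂ) * Complex.I * (n : ℂ)) φ) := by
  have hpi := Real.pi_pos
  refine ⟨⟨exists_closedSoliton, fun φ ψ hφ hψ => hφ.eq_translate (by simpa) hψ⟩, ?_⟩
  rintro n hn ⟨φ, hφ⟩
  have hn' : (2 : ℝ) ≤ n := by exact_mod_cast hn
  have him : ((2 : ℂ) * (Real.pi : ℂ) * Complex.I * (n : ℂ)).im = 2 * Real.pi * n := by simp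
  obtain ⟨x, hx⟩ := hφ.exists_im_eq Real.two_pi_pos (by rw [him]; nlinarith)
  have hb : 0 < ((2 : ℂ) * (Real.pi : ℂ) * Complex.I * (n : ℂ)).im := by rw [him]; positivity
  have hlt := one_add_mul_exp_neg_lt_one (hφ.re_neg hb x).ne
  rw [hφ.cos_im, hx, Real.cos_two_pi] at hlt
  exact lt_irrefl _ hlt
end
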